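/- arXiv:0802.2592 — 2 statements merged into one kernel-verified Lean document; each statement's English description precedes it below -/
import Mathlib

section
/- For x^n ∈ W^n = {x ∈ ℤ^n : x_1 < ... < x_n}, the number of tuples (x^1, ..., x^{n−1}) with x^k ∈ ℤ^k satisfying the interlacing conditions x^{k+1}_i ≤ x^k_i < x^{k+1}_{i+1} for all 1 ≤ k ≤ n−1 and 1 ≤ i ≤ k, equals h_n(x^n) / Π_{k=1}^{n−1} k!, where h_n(x) = Π_{i<j}(x_j − x_i). -/
open Matrix BigOperators

/-- Kronecker delta `δ_i : ℤ → ℝ`. -/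
noncomputable def deltaK (i : ℤ) : ℤ → ℝ := fun x => if x = i then 1 else 0

/-- Convolution `(f * g)(x) = Σ_{s+t=x} f(s) g(t)`. -/
noncomputable def conv (f g : ℤ → ℝ) : ℤ → ℝ := fun x => ∑' s : ℤ, f s * g (x - s)

/-- The Bernoulli(1/2) step distribution `φ = (δ_0 + δ_1)/2`. -/
noncomputable def phiB : ℤ → ℝ := fun x => (deltaK 0 x + deltaK 1 x) / 2

/-- `t`-fold convolution power of `φ`. -/
noncomputable def phiPow : ℕ → ℤ → ℝ
  | 0 => deltaK 0
  | (n+1) => conv (phiPow n) phiB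

/-- `Δ⁻¹ f (x) = Σ_{z ≤ x} f(z)`. -/
noncomputable def Dinv (f : ℤ → ℝ) (x : ℤ) : ℝ := ∑' z : {z : ℤ // z ≤ x}, f z.1

/-- Backward difference `Δ f (x) = f(x) - f(x-1)`. -/
noncomputable def Dd (f : ℤ → ℝ) (x : ℤ) : ℝ := f x - f (x - 1)

/-- Vandermonde product `h_n(z) = Π_{i<j} (z_j - z_i)` (real valued). -/
noncomputable def vand (n : ℕ) (z : Fin n → ℤ) : ℝ :=
  ∏ i : Fin n, ∏ j ∈ Finset.Ioi i, ((z j - z i : ℤ) : ℝ)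

/-- The interlacing cone `W^{n+1,n}`: `x_1 ≤ y_1 < x_2 ≤ … ≤ y_n < x_{n+1}`. -/
def interlace (n : ℕ) (x : Fin (n+1) → ℤ) (y : Fin n → ℤ) : Prop :=
  ∀ i : Fin n, x i.castSucc ≤ y i ∧ y i < x i.succ

/-- The determinantal kernel `q_t^n((x,y),(x',y'))` (rows indexed by the starting
point `(x,y)`, columns by the end point `(x',y')`). -/
noncomputable def qker (n t : ℕ) (x : Fin (n+1) → ℤ) (y : Fin n → ℤ)
    (x' : Fin (n+1) → ℤ) (y' : Fin n → ℤ) : ℝ :=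
  (Matrix.fromBlocks
    (Matrix.of fun i j : Fin (n+1) => phiPow t (x' j - x i))
    (Matrix.of fun (i : Fin (n+1)) (j : Fin n) =>
      Dinv (phiPow t) (y' j - x i) - if (i : ℕ) ≤ (j : ℕ) then 1 else 0)
    (Matrix.of fun (i : Fin n) (j : Fin (n+1)) => Dd (phiPow t) (x' j - y i))
    (Matrix.of fun i j : Fin n => phiPow t (y' j - y i))).det

/-- `λ^n(x,y) = n! h_n(y)/h_{n+1}(x)`. -/
noncomputable def lam (n : ℕ) (x : Fin (n+1) → ℤ) (y : Fin n → ℤ) : ℝ :=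
  (n.factorial : ℝ) * vand n y / vand (n+1) x

/-- `p_t^{n,+}(y,y') = (h_n(y')/h_n(y)) det[φ^{(t)}(y'_j - y_i)]`. -/
noncomputable def pplus (n t : ℕ) (y y' : Fin n → ℤ) : ℝ :=
  (vand n y' / vand n y) * (Matrix.of fun i j : Fin n => phiPow t (y' j - y i)).det


/-- Full row `j` (for `j ≤ m`) of an interlacing array with prescribed top row:
rows `j < m` come from `X` and row `m` is `top`.  Row `j` represents `x^{j+1}`. -/
def GTrow {α : Type*} (m : ℕ) (top : Fin (m+1) → α)
    (X : (k : Fin m) → Fin ((k : ℕ)+1) → α) (j : ℕ) (hj : j < m + 1) :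
    Fin (j+1) → α :=
  if h : j < m then X ⟨j, h⟩ else fun i => top (Fin.cast (by omega) i)

/-- The set of Gelfand–Tsetlin type interlacing arrays `(x^1, …, x^n)` of integers
with top row `x^n = top`, with interlacing `x^{k+1}_i ≤ x^k_i < x^{k+1}_{i+1}`. -/
def GTset (m : ℕ) (top : Fin (m+1) → ℤ) : Set ((k : Fin m) → Fin ((k : ℕ)+1) → ℤ) :=
  {X | ∀ (k : ℕ) (hk : k < m) (i : Fin (k+1)),
      GTrow m top X (k+1) (by omega) i.castSucc ≤ GTrow m top X k (by omega) i ∧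
      GTrow m top X k (by omega) i < GTrow m top X (k+1) (by omega) i.succ}

open Polynomial

/-- The forward difference of a falling factorial is a multiple of the previous one. -/
lemma descPochhammer_eval_add_one_sub {R : Type*} [CommRing R] (n : ℕ) (x : R) :
    (descPochhammer R (n + 1)).eval (x + 1) - (descPochhammer R (n + 1)).eval x
      = (n + 1) * (descPochhammer R n).eval x := by
  have h : (descPochhammer R (n + 1)).eval (x + 1) = (x + 1) * (descPochhammer R n).eval x := by
    simp [descPochhammer_succ_left]
  rw [h, descPochhammer_succ_eval]
  ring

lemma sum_Ico_descPochhammer_eval {R : Type*} [CommRing R] (n : ℕ) {a b : ℤ} (hab : a ≤ b) :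
    (n + 1) * ∑ y ∈ Finset.Ico a b, (descPochhammer R n).eval (y : R)
      = (descPochhammer R (n + 1)).eval (b : R) - (descPochhammer R (n + 1)).eval (a : R) := by
  induction b, hab using Int.leInduction with
  | base => simp
  | succ b hab ih =>
    rw [← Finset.insert_Ico_right_eq_Ico_add_one hab, Finset.sum_insert (by simp), mul_add, ih,
      ← descPochhammer_eval_add_one_sub]
    push_cast
    ring

lemma vand_eq_det_descPochhammer (n : ℕ) (z : Fin n → ℤ) :
    vand n z
      = (Matrix.of fun i j : Fin n => (descPochhammer ℝ (j : ℕ)).eval (z i : ℝ)).det := by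
  rw [← Matrix.det_eval_matrixOfPolynomials_eq_det_vandermonde _
    (fun j : Fin n => descPochhammer ℝ (j : ℕ)) (fun j => descPochhammer_natDegree ℝ j)
    (fun j => monic_descPochhammer ℝ j), Matrix.det_vandermonde]
  simp [vand]

/-- If the first column of a square matrix is constantly one, its determinant is that of the
matrix of differences of consecutive rows in the remaining columns. -/
lemma Matrix.det_eq_det_row_sub_of_column_zero_eq_one {R : Type*} [CommRing R] {n : ℕ}
    (A : Matrix (Fin (n + 1)) (Fin (n + 1)) R) (hA : ∀ i, A i 0 = 1) :
    A.det = (Matrix.of fun i j : Fin n => A i.succ j.succ - A i.castSucc j.succ).det := by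
  let B : Matrix (Fin (n + 1)) (Fin (n + 1)) R := Matrix.of fun i j =>
    Fin.cases (motive := fun _ => R) (A 0 j) (fun k => A k.succ j - A k.castSucc j) i
  have hAB : A.det = B.det := Matrix.det_eq_of_forall_row_eq_smul_add_pred (fun _ => 1)
    (fun j => by simp [B]) (fun i j => by simp [B])
  rw [hAB, Matrix.det_succ_column_zero, Fin.sum_univ_succ]
  have hB : ∀ i : Fin n, B i.succ 0 = 0 := fun i => by simp [B, hA]
  have hB0 : B 0 0 = 1 := by simp [B, hA]
  simp only [hB, hB0, mul_zero, zero_mul, Finset.sum_const_zero, add_zero, Fin.val_zero, pow_zero,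
    one_mul]
  rfl

/-- The vectors interlacing with `x`. -/
noncomputable def interlaceFinset (n : ℕ) (x : Fin (n + 1) → ℤ) : Finset (Fin n → ℤ) :=
  Fintype.piFinset fun i => Finset.Ico (x i.castSucc) (x i.succ)

lemma mem_interlaceFinset {n : ℕ} {x : Fin (n + 1) → ℤ} {y : Fin n → ℤ} :
    y ∈ interlaceFinset n x ↔ interlace n x y := by
  simp [interlaceFinset, interlace]

lemma interlace.strictMono {n : ℕ} {x : Fin (n + 1) → ℤ} {y : Fin n → ℤ}
    (h : interlace n x y) : StrictMono y := by
  cases n with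
  | zero => exact fun i => i.elim0
  | succ n =>
    refine Fin.strictMono_iff_lt_succ.2 fun i => (h i.castSucc).2.trans_le ?_
    rw [Fin.succ_castSucc]
    exact (h i.succ).1

lemma factorial_mul_sum_vand (n : ℕ) {x : Fin (n + 1) → ℤ} (hx : Monotone x) :
    (n.factorial : ℝ) * ∑ y ∈ interlaceFinset n x, vand n y = vand (n + 1) x := by
  have hsum : ∑ y ∈ interlaceFinset n x, vand n y
      = (Matrix.of fun i j : Fin n => ∑ y ∈ Finset.Ico (x i.castSucc) (x i.succ),
          (descPochhammer ℝ (j : ℕ)).eval (y : ℝ)).det := by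
    have h := (Matrix.detRowAlternating (R := ℝ) (n := Fin n)).toMultilinearMap.map_sum_finset
      (fun _ (y : ℤ) (j : Fin n) => (descPochhammer ℝ (j : ℕ)).eval (y : ℝ))
      (fun i => Finset.Ico (x i.castSucc) (x i.succ))
    simp only [vand_eq_det_descPochhammer]
    refine h.symm.trans (congrArg Matrix.det ?_)
    ext i j
    simp [Finset.sum_apply]
  have hfac : (n.factorial : ℝ) = ∏ j : Fin n, ((j : ℕ) + 1 : ℝ) := by
    rw [Fin.prod_univ_eq_prod_range (fun j => (j + 1 : ℝ)),
      ← Finset.prod_range_add_one_eq_factorial]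
    push_cast
    rfl
  rw [hsum, hfac, ← Matrix.det_mul_row, vand_eq_det_descPochhammer,
    Matrix.det_eq_det_row_sub_of_column_zero_eq_one _ (by simp)]
  congr 1
  ext i j
  simp [sum_Ico_descPochhammer_eval _ (hx i.castSucc_le_succ)]

lemma GTrow_self {α : Type*} (m : ℕ) (top : Fin (m + 1) → α)
    (X : (k : Fin m) → Fin ((k : ℕ) + 1) → α) (h : m < m + 1) : GTrow m top X m h = top := by
  simp [GTrow]

/-- Removing the top row turns the second row into the new top row. -/
lemma GTrow_succ {α : Type*} (m : ℕ) (top : Fin (m + 2) → α)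
    (X : (k : Fin (m + 1)) → Fin ((k : ℕ) + 1) → α) (j : ℕ) (hj : j < m + 1) :
    GTrow (m + 1) top X j (by omega)
      = GTrow m (X (Fin.last m)) (fun k => X k.castSucc) j hj := by
  obtain h | rfl := Nat.lt_succ_iff_lt_or_eq.1 hj
  · simp [GTrow, h, hj]
  · simp only [GTrow, hj, lt_irrefl, dite_true, dite_false]
    rfl

lemma mem_GTset_succ {m : ℕ} {top : Fin (m + 2) → ℤ}
    {X : (k : Fin (m + 1)) → Fin ((k : ℕ) + 1) → ℤ} :
    X ∈ GTset (m + 1) top ↔ X (Fin.last m) ∈ interlaceFinset (m + 1) top ∧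
      (fun k : Fin m => X k.castSucc) ∈ GTset m (X (Fin.last m)) := by
  rw [mem_interlaceFinset]
  constructor
  · intro h
    refine ⟨fun i => ?_, fun k hk i => ?_⟩
    · have := h m (by omega) i
      rwa [GTrow_self, GTrow_succ _ _ _ _ (by omega), GTrow_self] at this
    · have := h k (by omega) i
      rwa [GTrow_succ _ _ _ _ (by omega), GTrow_succ _ _ _ _ (by omega)] at this
  · rintro ⟨htop, h⟩ k hk i
    obtain hk' | rfl := Nat.lt_succ_iff_lt_or_eq.1 hk
    · rw [GTrow_succ _ _ _ _ (by omega), GTrow_succ _ _ _ _ (by omega)]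
      exact h k hk' i
    · rw [GTrow_self, GTrow_succ _ _ _ _ (by omega), GTrow_self]
      exact htop i

/-- An array below `top` is a row interlacing with `top` together with an array below that row. -/
noncomputable def GTsetSuccEquiv (m : ℕ) (top : Fin (m + 2) → ℤ) :
    GTset (m + 1) top ≃ Σ y : interlaceFinset (m + 1) top, GTset m y.1 where
  toFun X := ⟨⟨X.1 (Fin.last m), (mem_GTset_succ.1 X.2).1⟩,
    ⟨fun k => X.1 k.castSucc, (mem_GTset_succ.1 X.2).2⟩⟩
  invFun p := ⟨Fin.snoc (α := fun k : Fin (m + 1) => Fin ((k : ℕ) + 1) → ℤ) p.2.1 p.1.1,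
    mem_GTset_succ.2 (by simp only [Fin.snoc_last, Fin.snoc_castSucc]; exact ⟨p.1.2, p.2.2⟩)⟩
  left_inv X := Subtype.ext (Fin.snoc_init_self X.1)
  right_inv p := Sigma.subtype_ext
    (p := fun (y : interlaceFinset (m + 1) top) Z => Z ∈ GTset m y.1) (by simp) (by simp)

instance finite_GTset (m : ℕ) (top : Fin (m + 1) → ℤ) : Finite (GTset m top) := by
  induction m with
  | zero => infer_instance
  | succ m ih => exact Finite.of_equiv _ (GTsetSuccEquiv m top).symm

lemma card_GTset_succ (m : ℕ) (top : Fin (m + 2) → ℤ) :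
    Nat.card (GTset (m + 1) top) = ∑ y ∈ interlaceFinset (m + 1) top, Nat.card (GTset m y) := by
  rw [Nat.card_congr (GTsetSuccEquiv m top), Nat.card_sigma,
    Finset.sum_coe_sort (interlaceFinset (m + 1) top) fun y => Nat.card (GTset m y)]

/-- the number of interlacing arrays below a fixed top row `x^n`
equals `h_n(x^n) / Π_{k<n} k!` (here `n = m+1`). -/
theorem card_GTset (m : ℕ) (top : Fin (m+1) → ℤ) (htop : StrictMono top) :
    (Nat.card (GTset m top) : ℝ)
      = vand (m+1) top / ∏ k ∈ Finset.range (m+1), (k.factorial : ℝ) := by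
  induction m with
  | zero =>
    have h : GTset 0 top = Set.univ := Set.eq_univ_of_forall fun X k hk => absurd hk k.not_lt_zero
    simp [h, vand]
  | succ m ih =>
    rw [card_GTset_succ, Nat.cast_sum,
      Finset.sum_congr rfl fun y hy => ih y (mem_interlaceFinset.1 hy).strictMono,
      ← Finset.sum_div, ← factorial_mul_sum_vand (m + 1) htop.monotone,
      Finset.prod_range_succ _ (m + 1), mul_comm (∏ k ∈ Finset.range (m + 1), (k.factorial : ℝ)),
      mul_div_mul_left _ _ (Nat.cast_ne_zero.2 (m + 1).factorial_ne_zero)]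
end

section
/- The entrance-law identity for Warren's process: for s, t > 0 and (x', y') ∈ W^{n,n+1} (reals with x'_1 < y'_1 < x'_2 < ... < y'_n < x'_{n+1}), ∫_{W^{n,n+1}} ν_s^n(x,y) q_t^{n,+}((x,y),(x',y')) dx dy = ν_{s+t}^n(x',y'), where ν_t^n(x,y) = (n!/Z_{n+1}) t^{−(n+1)²/2} exp(−Σ_i x_i²/(2t)) Π_{i<j}(x_j−x_i) Π_{i<j}(y_j−y_i), Z_{n+1} = (2π)^{(n+1)/2} Π_{j≤n} j!, and q_t^{n,+}((x,y),(x',y')) = (h_n(y')/h_n(y)) det[A_t(x,x'), B_t(x,y'); C_t(y,x'), D_t(y,y')] with A entries φ_t(x'_i−x_j), B entries Φ_t(y'_i−x_j)−1{j≥i}, C entries φ'_t(y'_i−x_j), D entries φ_t(y'_i−y_j), φ_t the centered Gaussian density of variance t and Φ_t its CDF. -/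
open Matrix MeasureTheory

/-- Vandermonde product `h_n(z) = Π_{i<j}(z_j - z_i)`. -/
noncomputable def vandR (n : ℕ) (z : Fin n → ℝ) : ℝ :=
  ∏ i : Fin n, ∏ j ∈ Finset.Ioi i, (z j - z i)

/-- Centered Gaussian density of variance `t`. -/
noncomputable def gauss (t x : ℝ) : ℝ :=
  Real.exp (-x^2 / (2*t)) / Real.sqrt (2 * Real.pi * t)

/-- Centered Gaussian CDF of variance `t`. -/
noncomputable def gaussCdf (t x : ℝ) : ℝ := ∫ u in Set.Iic x, gauss t u

/-- Warren's determinantal kernel `q_t^n` (rows indexed by the starting point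
`(x,y)`, columns by the end point `(x',y')`). -/
noncomputable def qkerC (n : ℕ) (t : ℝ) (x : Fin (n+1) → ℝ) (y : Fin n → ℝ)
    (x' : Fin (n+1) → ℝ) (y' : Fin n → ℝ) : ℝ :=
  (Matrix.fromBlocks
    (Matrix.of fun i j : Fin (n+1) => gauss t (x' j - x i))
    (Matrix.of fun (i : Fin (n+1)) (j : Fin n) =>
      gaussCdf t (y' j - x i) - if (i : ℕ) ≤ (j : ℕ) then 1 else 0)
    (Matrix.of fun (i : Fin n) (j : Fin (n+1)) => deriv (gauss t) (x' j - y i))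
    (Matrix.of fun i j : Fin n => gauss t (y' j - y i))).det

/-- Warren's entrance law `ν_t^n(x,y)`, with
`Z_{n+1} = (2π)^{(n+1)/2} Π_{j ≤ n} j!`. -/
noncomputable def nuC (n : ℕ) (t : ℝ) (x : Fin (n+1) → ℝ) (y : Fin n → ℝ) : ℝ :=
  ((n.factorial : ℝ)
      / ((2 * Real.pi) ^ (((n : ℝ) + 1) / 2)
          * ∏ j ∈ Finset.range (n+1), (j.factorial : ℝ)))
    * t ^ (-(((n : ℝ) + 1)^2) / 2)
    * Real.exp (-(∑ i, (x i)^2) / (2*t))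
    * vandR (n+1) x * vandR n y

/-- The continuous interlacing cone `W^{n,n+1}`. -/
def WC (n : ℕ) : Set ((Fin (n+1) → ℝ) × (Fin n → ℝ)) :=
  {p | ∀ i : Fin n, p.1 i.castSucc < p.2 i ∧ p.2 i < p.1 i.succ}

theorem gauss_eq_gaussianPDFReal {t : ℝ} (ht : 0 < t) :
    gauss t = ProbabilityTheory.gaussianPDFReal 0 ⟨t, ht.le⟩ := by
  ext x
  simp only [gauss, ProbabilityTheory.gaussianPDFReal, sub_zero]
  exact div_eq_inv_mul _ _

theorem continuous_gauss (t : ℝ) : Continuous (gauss t) := by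
  unfold gauss
  fun_prop

theorem integrable_gauss {t : ℝ} (ht : 0 < t) : Integrable (gauss t) := by
  rw [gauss_eq_gaussianPDFReal ht]
  exact ProbabilityTheory.integrable_gaussianPDFReal _ _

theorem integral_gauss {t : ℝ} (ht : 0 < t) : ∫ x, gauss t x = 1 := by
  rw [gauss_eq_gaussianPDFReal ht]
  exact ProbabilityTheory.integral_gaussianPDFReal_eq_one _
    (fun h => ht.ne' (congrArg NNReal.toReal h))

theorem gauss_nonneg (t x : ℝ) : 0 ≤ gauss t x := by
  unfold gauss
  positivity

theorem norm_gauss_le {t : ℝ} (ht : 0 < t) (x : ℝ) :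
    ‖gauss t x‖ ≤ 1 / Real.sqrt (2 * Real.pi * t) := by
  rw [Real.norm_of_nonneg (gauss_nonneg t x), gauss]
  gcongr
  rw [Real.exp_le_one_iff, neg_div]
  have : 0 ≤ x ^ 2 / (2 * t) := by positivity
  linarith

theorem hasDerivAt_gauss (t x : ℝ) :
    HasDerivAt (gauss t) (-(x / t) * gauss t x) x := by
  have h := (((hasDerivAt_pow 2 x).neg.div_const (2 * t)).exp).div_const
    (Real.sqrt (2 * Real.pi * t))
  refine h.congr_deriv ?_
  simp only [gauss, Pi.neg_apply]
  push_cast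
  rw [show -(2 * x ^ (2 - 1)) / (2 * t) = -(x / t) by
    rw [neg_div, mul_div_mul_left _ _ two_ne_zero]; simp]
  ring

theorem deriv_gauss (t : ℝ) : deriv (gauss t) = fun x => -(x / t) * gauss t x :=
  funext fun x => (hasDerivAt_gauss t x).deriv

theorem continuous_deriv_gauss (t : ℝ) : Continuous (deriv (gauss t)) := by
  rw [deriv_gauss]
  exact (continuous_id.div_const t).neg.mul (continuous_gauss t)

theorem integrable_pow_mul_exp_neg_sq_div {s : ℝ} (hs : 0 < s) (k : ℕ) :
    Integrable fun x : ℝ => x ^ k * Real.exp (-x ^ 2 / (2 * s)) := by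
  have h := integrable_rpow_mul_exp_neg_mul_sq (b := 1 / (2 * s)) (by positivity)
    (s := (k : ℝ)) (by have := k.cast_nonneg (α := ℝ); linarith)
  refine h.congr (Filter.Eventually.of_forall fun x => ?_)
  simp only [Real.rpow_natCast]
  congr 2
  ring

theorem integrable_pow_mul_gauss {t : ℝ} (ht : 0 < t) (k : ℕ) :
    Integrable fun x : ℝ => x ^ k * gauss t x := by
  simpa only [gauss, mul_div_assoc] using
    (integrable_pow_mul_exp_neg_sq_div ht k).div_const (Real.sqrt (2 * Real.pi * t))

theorem integrable_deriv_gauss {t : ℝ} (ht : 0 < t) : Integrable (deriv (gauss t)) := by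
  rw [deriv_gauss]
  refine ((integrable_pow_mul_gauss ht 1).const_mul (-1 / t)).congr
    (Filter.Eventually.of_forall fun x => ?_)
  ring

theorem gaussCdf_sub_gaussCdf {t : ℝ} (ht : 0 < t) (a b : ℝ) :
    gaussCdf t b - gaussCdf t a = ∫ u in a..b, gauss t u :=
  intervalIntegral.integral_Iic_sub_Iic (integrable_gauss ht).integrableOn
    (integrable_gauss ht).integrableOn

theorem measurable_gaussCdf {t : ℝ} (ht : 0 < t) : Measurable (gaussCdf t) := by
  refine Monotone.measurable fun a b hab => ?_
  rw [← sub_nonneg, gaussCdf_sub_gaussCdf ht]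
  exact intervalIntegral.integral_nonneg hab fun u _ => gauss_nonneg t u

theorem abs_gaussCdf_le_one {t : ℝ} (ht : 0 < t) (x : ℝ) : |gaussCdf t x| ≤ 1 := by
  rw [gaussCdf, abs_of_nonneg (integral_nonneg fun u => gauss_nonneg t u), ← integral_gauss ht]
  exact setIntegral_le_integral (integrable_gauss ht)
    (Filter.Eventually.of_forall fun u => gauss_nonneg t u)

theorem setIntegral_gauss_sub {t : ℝ} (ht : 0 < t) {a b : ℝ} (hab : a ≤ b) (d : ℝ) :
    ∫ y in Set.Ioo a b, gauss t (d - y) = gaussCdf t (d - a) - gaussCdf t (d - b) := by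
  rw [← integral_Ioc_eq_integral_Ioo, ← intervalIntegral.integral_of_le hab,
    intervalIntegral.integral_comp_sub_left, gaussCdf_sub_gaussCdf ht]

theorem setIntegral_deriv_gauss_sub (t : ℝ) {a b : ℝ} (hab : a ≤ b) (d : ℝ) :
    ∫ y in Set.Ioo a b, deriv (gauss t) (d - y) = gauss t (d - a) - gauss t (d - b) := by
  rw [← integral_Ioc_eq_integral_Ioo, ← intervalIntegral.integral_of_le hab,
    intervalIntegral.integral_comp_sub_left]
  exact intervalIntegral.integral_deriv_eq_sub
    (fun x _ => (hasDerivAt_gauss t x).differentiableAt)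
    ((continuous_deriv_gauss t).intervalIntegrable _ _)

theorem exp_mul_gauss_sub {s t : ℝ} (hs : 0 < s) (ht : 0 < t) (a x : ℝ) :
    Real.exp (-x ^ 2 / (2 * s)) * gauss t (a - x) =
      (Real.sqrt (s / (s + t)) * Real.exp (-a ^ 2 / (2 * (s + t)))) *
        gauss (s * t / (s + t)) (x - s / (s + t) * a) := by
  have hst : 0 < s + t := by positivity
  have h1 : Real.sqrt (2 * Real.pi * (s * t / (s + t))) =
      Real.sqrt (s / (s + t)) * Real.sqrt (2 * Real.pi * t) := by
    rw [← Real.sqrt_mul (by positivity)]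
    congr 1
    ring
  have h2 : 0 < Real.sqrt (s / (s + t)) := Real.sqrt_pos.2 (by positivity)
  have h3 : 0 < Real.sqrt (2 * Real.pi * t) := Real.sqrt_pos.2 (by positivity)
  have h4 : Real.exp (-x ^ 2 / (2 * s)) * Real.exp (-(a - x) ^ 2 / (2 * t)) =
      Real.exp (-a ^ 2 / (2 * (s + t))) *
        Real.exp (-(x - s / (s + t) * a) ^ 2 / (2 * (s * t / (s + t)))) := by
    rw [← Real.exp_add, ← Real.exp_add]
    congr 1
    field_simp
    ring
  rw [gauss, gauss, h1, ← mul_div_assoc, h4]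
  field_simp

/-- The polynomial `m ↦ E[(m + Z)^j]` for a centered Gaussian `Z` of variance `v`. -/
noncomputable def gaussMomentPoly (v : ℝ) (j : ℕ) : Polynomial ℝ :=
  ∑ k ∈ Finset.range (j + 1),
    Polynomial.monomial k ((j.choose k : ℝ) * ∫ z, z ^ (j - k) * gauss v z)

theorem gaussMomentPoly_eq {v : ℝ} (hv : 0 < v) (j : ℕ) :
    ∃ q : Polynomial ℝ, q.degree < j ∧ gaussMomentPoly v j = Polynomial.X ^ j + q := by
  refine ⟨∑ k ∈ Finset.range j,
    Polynomial.monomial k ((j.choose k : ℝ) * ∫ z, z ^ (j - k) * gauss v z), ?_, ?_⟩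
  swap
  · rw [gaussMomentPoly, Finset.sum_range_succ, add_comm]
    simp only [Nat.choose_self, Nat.cast_one, Nat.sub_self, pow_zero, one_mul,
      integral_gauss hv, Polynomial.monomial_one_right_eq_X_pow]
  refine (Polynomial.degree_sum_le _ _).trans_lt ?_
  rw [Finset.sup_lt_iff (WithBot.bot_lt_coe _)]
  intro k hk
  exact (Polynomial.degree_monomial_le _ _).trans_lt (by exact_mod_cast Finset.mem_range.1 hk)

theorem monic_gaussMomentPoly {v : ℝ} (hv : 0 < v) (j : ℕ) : (gaussMomentPoly v j).Monic := by
  obtain ⟨q, hq, h⟩ := gaussMomentPoly_eq hv j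
  rw [h]
  exact Polynomial.monic_X_pow_add hq

theorem natDegree_gaussMomentPoly {v : ℝ} (hv : 0 < v) (j : ℕ) :
    (gaussMomentPoly v j).natDegree = j := by
  obtain ⟨q, hq, h⟩ := gaussMomentPoly_eq hv j
  rw [h]
  refine Polynomial.natDegree_eq_of_degree_eq_some ?_
  rw [Polynomial.degree_add_eq_left_of_degree_lt (by rwa [Polynomial.degree_X_pow]),
    Polynomial.degree_X_pow]

theorem integral_pow_mul_gauss_sub {v : ℝ} (hv : 0 < v) (j : ℕ) (m : ℝ) :
    ∫ x, x ^ j * gauss v (x - m) = (gaussMomentPoly v j).eval m := by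
  rw [← integral_add_right_eq_self _ m]
  simp only [add_sub_cancel_right, gaussMomentPoly, Polynomial.eval_finsetSum,
    Polynomial.eval_monomial]
  have h : ∀ z : ℝ, (z + m) ^ j * gauss v z = ∑ k ∈ Finset.range (j + 1),
      (j.choose k : ℝ) * m ^ k * (z ^ (j - k) * gauss v z) := fun z => by
    rw [add_comm z m, add_pow, Finset.sum_mul]
    exact Finset.sum_congr rfl fun k _ => by ring
  simp only [h]
  rw [integral_finsetSum _ fun k _ => (integrable_pow_mul_gauss hv _).const_mul _]
  refine Finset.sum_congr rfl fun k _ => ?_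
  rw [integral_const_mul]
  ring

theorem integrable_exp_mul_gauss_sub_mul_pow {s t : ℝ} (hs : 0 < s) (ht : 0 < t) (a : ℝ) (j : ℕ) :
    Integrable fun x : ℝ => Real.exp (-x ^ 2 / (2 * s)) * gauss t (a - x) * x ^ j := by
  refine ((integrable_pow_mul_exp_neg_sq_div hs j).bdd_mul (f := fun x => gauss t (a - x))
    ((continuous_gauss t).comp (continuous_const.sub continuous_id)).aestronglyMeasurable
    (Filter.Eventually.of_forall fun x => norm_gauss_le ht _)).congr
    (Filter.Eventually.of_forall fun x => ?_)
  ring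

theorem integral_exp_mul_gauss_sub_mul_pow {s t : ℝ} (hs : 0 < s) (ht : 0 < t) (a : ℝ) (j : ℕ) :
    ∫ x, Real.exp (-x ^ 2 / (2 * s)) * gauss t (a - x) * x ^ j =
      (Real.sqrt (s / (s + t)) * Real.exp (-a ^ 2 / (2 * (s + t)))) *
        (gaussMomentPoly (s * t / (s + t)) j).eval (s / (s + t) * a) := by
  rw [← integral_pow_mul_gauss_sub (by positivity), ← integral_const_mul]
  refine integral_congr_ae (Filter.Eventually.of_forall fun x => ?_)
  simp only [exp_mul_gauss_sub hs ht]
  ring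

section Determinants

variable {ι κ : Type*} [Fintype ι] [Fintype κ] [DecidableEq ι] [DecidableEq κ]

theorem det_eq_sum_prod_rows (M : Matrix ι ι ℝ) :
    M.det = ∑ σ : Equiv.Perm ι, ((Equiv.Perm.sign σ : ℤ) : ℝ) * ∏ i, M i (σ i) := by
  rw [← Matrix.det_transpose, Matrix.det_apply']
  rfl

theorem integrable_det_rows {f : ι → ι → ℝ → ℝ} (hf : ∀ i j, Integrable (f i j)) :
    Integrable fun x : ι → ℝ => (Matrix.of fun i j => f i j (x i)).det := by
  simp only [det_eq_sum_prod_rows, Matrix.of_apply]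
  exact integrable_finsetSum _ fun σ _ =>
    (Integrable.fintype_prod fun i => hf i (σ i)).const_mul _

theorem integral_det_rows {f : ι → ι → ℝ → ℝ} (hf : ∀ i j, Integrable (f i j)) :
    ∫ x : ι → ℝ, (Matrix.of fun i j => f i j (x i)).det =
      (Matrix.of fun i j => ∫ u, f i j u).det := by
  simp only [det_eq_sum_prod_rows, Matrix.of_apply]
  rw [integral_finsetSum _ fun σ _ =>
    (Integrable.fintype_prod fun i => hf i (σ i)).const_mul _]
  refine Finset.sum_congr rfl fun σ _ => ?_
  rw [integral_const_mul, integral_fintype_prod_volume_eq_prod fun i => f i (σ i)]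

theorem integrable_mul_det_rows_sum {F : (ι → ℝ) → ℝ} (hF : Integrable F)
    {u : ι → ι ⊕ κ → ℝ → ℝ} (hu : ∀ i j, Measurable (u i j)) {c : ℝ} (hc : ∀ i j z, |u i j z| ≤ c)
    {f : κ → ι ⊕ κ → ℝ → ℝ} (hf : ∀ k j, Integrable (f k j)) :
    Integrable fun p : (ι → ℝ) × (κ → ℝ) =>
      F p.1 * (Matrix.of (Sum.elim (fun i j => u i j (p.1 i)) fun k j => f k j (p.2 k))).det := by
  simp only [det_eq_sum_prod_rows, Matrix.of_apply, Fintype.prod_sum_type, Sum.elim_inl,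
    Sum.elim_inr, Finset.mul_sum]
  refine integrable_finsetSum _ fun σ _ => ?_
  have hx : Integrable fun x : ι → ℝ => (∏ i, u i (σ (Sum.inl i)) (x i)) * F x := by
    refine hF.bdd_mul (c := ∏ _i : ι, c) ?_ (Filter.Eventually.of_forall fun x => ?_)
    · exact (Finset.measurable_prod _ fun i _ =>
        (hu i _).comp (measurable_pi_apply i)).aestronglyMeasurable
    · rw [norm_prod]
      exact Finset.prod_le_prod (fun i _ => norm_nonneg _) fun i _ => hc i _ _
  have hy : Integrable fun y : κ → ℝ => ∏ k, f k (σ (Sum.inr k)) (y k) :=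
    Integrable.fintype_prod fun k => hf k (σ (Sum.inr k))
  refine ((hx.mul_prod hy).const_mul ((Equiv.Perm.sign σ : ℤ) : ℝ)).congr
    (Filter.Eventually.of_forall fun p => ?_)
  ring

theorem setIntegral_pi_det_rows_sum (u : ι → ι ⊕ κ → ℝ) {f : κ → ι ⊕ κ → ℝ → ℝ}
    (hf : ∀ k j, Integrable (f k j)) (S : κ → Set ℝ) :
    ∫ y in Set.univ.pi S, (Matrix.of (Sum.elim u fun k j => f k j (y k))).det =
      (Matrix.of (Sum.elim u fun k j => ∫ z in S k, f k j z)).det := by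
  simp only [det_eq_sum_prod_rows, Matrix.of_apply, Fintype.prod_sum_type, Sum.elim_inl,
    Sum.elim_inr]
  rw [volume_pi, Measure.restrict_pi_pi, integral_finsetSum _ fun σ _ =>
    ((Integrable.fintype_prod fun k => (hf k (σ (Sum.inr k))).restrict).const_mul _).const_mul _]
  refine Finset.sum_congr rfl fun σ _ => ?_
  rw [integral_const_mul, integral_const_mul,
    integral_fintype_prod_eq_prod fun k => f k (σ (Sum.inr k))]

theorem det_fromBlocks_mul_add_one (A : Matrix ι ι ℝ) (B : Matrix ι κ ℝ) (L : Matrix κ ι ℝ) :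
    (Matrix.fromBlocks A B (L * A) (L * B + 1)).det = A.det := by
  have h : Matrix.fromBlocks A B (L * A) (L * B + 1) =
      Matrix.fromBlocks 1 0 L 1 * Matrix.fromBlocks A B 0 1 := by
    simp [Matrix.fromBlocks_multiply]
  rw [h, Matrix.det_mul, Matrix.det_fromBlocks_zero₁₂, Matrix.det_fromBlocks_zero₂₁]
  simp

end Determinants

section Chambers

variable {m : ℕ}

theorem ae_injective : ∀ᵐ x : Fin m → ℝ, Function.Injective x := by
  have h : ∀ i j : Fin m, i ≠ j → ∀ᵐ x : Fin m → ℝ, x i ≠ x j := fun i j hij => by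
    let V : Submodule ℝ (Fin m → ℝ) :=
      LinearMap.ker (LinearMap.proj (R := ℝ) (φ := fun _ : Fin m => ℝ) i - LinearMap.proj j)
    have hV : V ≠ ⊤ := fun hV => by
      have : Pi.single i (1 : ℝ) ∈ V := hV ▸ Submodule.mem_top
      simp [V, Pi.single_eq_of_ne hij.symm] at this
    refine measure_mono_null (fun x hx => ?_) (Measure.addHaar_submodule volume V hV)
    simpa [V, sub_eq_zero] using hx
  have h' : ∀ᵐ x : Fin m → ℝ, ∀ i j : Fin m, i ≠ j → x i ≠ x j := by
    simpa only [ae_all_iff] using h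
  filter_upwards [h'] with x hx i j hij
  by_contra hne
  exact hx i j hne hij

theorem measurableSet_strictMono_comp (σ : Equiv.Perm (Fin m)) :
    MeasurableSet {x : Fin m → ℝ | StrictMono (x ∘ σ)} := by
  have h : {x : Fin m → ℝ | StrictMono (x ∘ σ)} =
      ⋂ i, ⋂ j, ⋂ _ : i < j, {x | x (σ i) < x (σ j)} := by
    ext x
    simp [StrictMono]
  rw [h]
  exact MeasurableSet.iInter fun i => MeasurableSet.iInter fun j => MeasurableSet.iInter fun _ =>
    measurableSet_lt (measurable_pi_apply _) (measurable_pi_apply _)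

theorem measurableSet_strictMono : MeasurableSet {x : Fin m → ℝ | StrictMono x} :=
  measurableSet_strictMono_comp 1

theorem pairwise_disjoint_strictMono_comp :
    Pairwise (Function.onFun Disjoint
      fun σ : Equiv.Perm (Fin m) => {x : Fin m → ℝ | StrictMono (x ∘ σ)}) := by
  intro σ τ hne
  refine Set.disjoint_left.2 fun x hσ hτ => hne ?_
  have hinj : Function.Injective x := by
    have := (StrictMono.injective hσ).comp σ.symm.injective
    simpa [Function.comp_assoc] using this
  ext i
  exact congrArg Fin.val
    (hinj (congrFun (Tuple.unique_monotone (StrictMono.monotone hσ) (StrictMono.monotone hτ)) i))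

theorem integral_eq_sum_setIntegral_strictMono {G : (Fin m → ℝ) → ℝ} (hG : Integrable G) :
    ∫ x, G x = ∑ σ : Equiv.Perm (Fin m), ∫ x in {x | StrictMono (x ∘ σ)}, G x := by
  rw [← integral_iUnion_fintype measurableSet_strictMono_comp pairwise_disjoint_strictMono_comp
    fun σ => hG.integrableOn, ← setIntegral_univ]
  refine setIntegral_congr_set (Filter.EventuallyEq.symm (Filter.eventuallyEq_univ.2 ?_))
  filter_upwards [ae_injective] with x hx
  exact Set.mem_iUnion.2 ⟨Tuple.sort x,
    (Tuple.monotone_sort x).strictMono_of_injective (hx.comp (Tuple.sort x).injective)⟩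

theorem coe_piCongrLeft_symm_perm (σ : Equiv.Perm (Fin m)) :
    ⇑(MeasurableEquiv.piCongrLeft (fun _ : Fin m => ℝ) σ.symm) = fun x => x ∘ σ := by
  funext x i
  rw [MeasurableEquiv.coe_piCongrLeft]
  simpa using Equiv.piCongrLeft_apply_apply (fun _ : Fin m => ℝ) σ.symm x (σ i)

theorem measurePreserving_comp_perm (σ : Equiv.Perm (Fin m)) :
    MeasurePreserving (fun x : Fin m → ℝ => x ∘ σ) volume volume :=
  coe_piCongrLeft_symm_perm σ ▸ volume_measurePreserving_piCongrLeft (fun _ : Fin m => ℝ) σ.symm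

theorem measurableEmbedding_comp_perm (σ : Equiv.Perm (Fin m)) :
    MeasurableEmbedding (fun x : Fin m → ℝ => x ∘ σ) :=
  coe_piCongrLeft_symm_perm σ ▸
    (MeasurableEquiv.piCongrLeft (fun _ : Fin m => ℝ) σ.symm).measurableEmbedding

/-- Integrating the symmetrization of `G` over the Weyl chamber gives the full integral of `G`. -/
theorem setIntegral_strictMono_sum_comp_perm {G : (Fin m → ℝ) → ℝ} (hG : Integrable G) :
    ∫ x in {x : Fin m → ℝ | StrictMono x}, ∑ σ : Equiv.Perm (Fin m), G (x ∘ σ) = ∫ x, G x := by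
  have hint : ∀ σ : Equiv.Perm (Fin m), Integrable fun x : Fin m → ℝ => G (x ∘ σ) := fun σ =>
    (measurePreserving_comp_perm σ).integrable_comp_of_integrable hG
  rw [integral_finsetSum _ fun σ _ => (hint σ).integrableOn,
    integral_eq_sum_setIntegral_strictMono hG]
  refine Fintype.sum_equiv (Equiv.inv _) _ _ fun σ => ?_
  rw [← (measurePreserving_comp_perm σ).setIntegral_preimage_emb
    (measurableEmbedding_comp_perm σ) G]
  congr 2
  ext x
  simp [Function.comp_assoc]

end Chambers

theorem vandR_eq_det (n : ℕ) (z : Fin n → ℝ) : vandR n z = (Matrix.vandermonde z).det :=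
  (Matrix.det_vandermonde z).symm

theorem vandR_comp_perm (n : ℕ) (z : Fin n → ℝ) (σ : Equiv.Perm (Fin n)) :
    vandR n (z ∘ σ) = ((Equiv.Perm.sign σ : ℤ) : ℝ) * vandR n z := by
  rw [vandR_eq_det, vandR_eq_det, ← Matrix.det_permute]
  rfl

theorem vandR_const_mul (n : ℕ) (c : ℝ) (z : Fin n → ℝ) :
    vandR n (fun i => c * z i) = c ^ (n * (n - 1) / 2) * vandR n z := by
  simp only [vandR, ← mul_sub, Finset.prod_mul_distrib, Finset.prod_const, Fin.card_Ioi]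
  rw [Finset.prod_pow_eq_pow_sum]
  congr 2
  rw [← Finset.sum_range_id_mul_two, Nat.mul_div_cancel _ two_pos,
    ← Finset.sum_range_reflect, Finset.sum_range]

theorem vandR_pos {n : ℕ} {z : Fin n → ℝ} (hz : StrictMono z) : 0 < vandR n z :=
  Finset.prod_pos fun _ _ => Finset.prod_pos fun _ hj => sub_pos.2 (hz (Finset.mem_Ioi.1 hj))

/-- Row of the kernel `qkerC` attached to a coordinate `z = x i` of the starting point. -/
noncomputable def qkerRowX {n : ℕ} (t : ℝ) (x' : Fin (n+1) → ℝ) (y' : Fin n → ℝ) (i : Fin (n+1)) :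
    Fin (n+1) ⊕ Fin n → ℝ → ℝ :=
  Sum.elim (fun j z => gauss t (x' j - z))
    (fun j z => gaussCdf t (y' j - z) - if (i : ℕ) ≤ (j : ℕ) then 1 else 0)

/-- Row of the kernel `qkerC` attached to a coordinate `z = y i` of the starting point. -/
noncomputable def qkerRowY {n : ℕ} (t : ℝ) (x' : Fin (n+1) → ℝ) (y' : Fin n → ℝ) :
    Fin (n+1) ⊕ Fin n → ℝ → ℝ :=
  Sum.elim (fun j z => deriv (gauss t) (x' j - z)) (fun j z => gauss t (y' j - z))

theorem qkerC_eq_det_rows (n : ℕ) (t : ℝ) (x : Fin (n+1) → ℝ) (y : Fin n → ℝ)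
    (x' : Fin (n+1) → ℝ) (y' : Fin n → ℝ) :
    qkerC n t x y x' y' = (Matrix.of (Sum.elim (fun i j => qkerRowX t x' y' i j (x i))
      fun k j => qkerRowY t x' y' j (y k))).det := by
  unfold qkerC
  congr 1
  ext (i | i) (j | j) <;> rfl

theorem measurable_qkerRowX {n : ℕ} {t : ℝ} (ht : 0 < t) (x' : Fin (n+1) → ℝ) (y' : Fin n → ℝ)
    (i : Fin (n+1)) (j : Fin (n+1) ⊕ Fin n) : Measurable (qkerRowX t x' y' i j) := by
  rcases j with j | j
  · exact (continuous_gauss t).measurable.comp (measurable_const.sub measurable_id)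
  · exact ((measurable_gaussCdf ht).comp (measurable_const.sub measurable_id)).sub measurable_const

theorem abs_qkerRowX_le {n : ℕ} {t : ℝ} (ht : 0 < t) (x' : Fin (n+1) → ℝ) (y' : Fin n → ℝ)
    (i : Fin (n+1)) (j : Fin (n+1) ⊕ Fin n) (z : ℝ) :
    |qkerRowX t x' y' i j z| ≤ max (1 / Real.sqrt (2 * Real.pi * t)) 2 := by
  rcases j with j | j
  · exact (norm_gauss_le ht _).trans (le_max_left _ _)
  · refine le_trans ?_ (le_max_right _ _)
    refine (abs_sub _ _).trans ?_
    have h1 := abs_gaussCdf_le_one ht (y' j - z)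
    have h2 : |(if (i : ℕ) ≤ (j : ℕ) then 1 else 0 : ℝ)| ≤ 1 := by split_ifs <;> simp
    linarith

theorem integrable_qkerRowY {n : ℕ} {t : ℝ} (ht : 0 < t) (x' : Fin (n+1) → ℝ) (y' : Fin n → ℝ)
    (j : Fin (n+1) ⊕ Fin n) : Integrable (qkerRowY t x' y' j) := by
  rcases j with j | j
  · exact (integrable_deriv_gauss ht).comp_sub_left _
  · exact (integrable_gauss ht).comp_sub_left _

/-- Integrating out the interlacing coordinates of the starting point turns the kernel into a
Karlin-McGregor determinant. -/
theorem setIntegral_qkerC {n : ℕ} {t : ℝ} (ht : 0 < t) {x : Fin (n+1) → ℝ} (hx : StrictMono x)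
    (x' : Fin (n+1) → ℝ) (y' : Fin n → ℝ) :
    ∫ y in Set.univ.pi fun i : Fin n => Set.Ioo (x i.castSucc) (x i.succ), qkerC n t x y x' y' =
      (Matrix.of fun i j => gauss t (x' j - x i)).det := by
  simp only [qkerC_eq_det_rows]
  rw [setIntegral_pi_det_rows_sum _ fun _ j => integrable_qkerRowY ht x' y' j]
  rw [← det_fromBlocks_mul_add_one (Matrix.of fun i j => gauss t (x' j - x i))
    (Matrix.of fun (i : Fin (n+1)) (j : Fin n) =>
      gaussCdf t (y' j - x i) - if (i : ℕ) ≤ (j : ℕ) then 1 else 0)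
    (Matrix.of fun (i : Fin n) (k : Fin (n+1)) =>
      (if k = i.castSucc then (1 : ℝ) else 0) - if k = i.succ then 1 else 0)]
  congr 1
  ext (i | i) (j | j)
  · rfl
  · rfl
  · simp only [Matrix.of_apply, Sum.elim_inr, Matrix.fromBlocks_apply₂₁, Matrix.mul_apply, sub_mul,
      ite_mul, one_mul, zero_mul, Finset.sum_sub_distrib, Finset.sum_ite_eq',
      Finset.mem_univ, if_true]
    exact setIntegral_deriv_gauss_sub t (hx.monotone i.castSucc_le_succ) _
  · simp only [Matrix.of_apply, Sum.elim_inr, Matrix.fromBlocks_apply₂₂, Matrix.mul_apply, sub_mul,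
      ite_mul, one_mul, zero_mul, Finset.sum_sub_distrib, Finset.sum_ite_eq',
      Finset.mem_univ, if_true, Matrix.add_apply, Matrix.one_apply]
    refine (setIntegral_gauss_sub ht (hx.monotone i.castSucc_le_succ) _).trans ?_
    simp only [Fin.val_castSucc, Fin.val_succ]
    rcases lt_trichotomy i j with h | h | h
    · have h' : (i : ℕ) < j := h
      rw [if_pos h'.le, if_pos (Nat.succ_le_of_lt h'), if_neg h.ne]
      ring
    · subst h
      simp only [le_refl, if_true, if_neg (Nat.not_succ_le_self _)]
      ring
    · have h' : (j : ℕ) < i := h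
      rw [if_neg h'.not_ge, if_neg (by omega), if_neg h.ne']
      ring

theorem measurableSet_WC (n : ℕ) : MeasurableSet (WC n) := by
  have h : WC n = ⋂ i : Fin n, {p | p.1 i.castSucc < p.2 i} ∩ {p | p.2 i < p.1 i.succ} := by
    ext p
    simp [WC]
  rw [h]
  refine MeasurableSet.iInter fun i => MeasurableSet.inter ?_ ?_ <;>
    exact measurableSet_lt (by fun_prop) (by fun_prop)

theorem strictMono_of_mem_WC {n : ℕ} {p : (Fin (n+1) → ℝ) × (Fin n → ℝ)} (hp : p ∈ WC n) :
    StrictMono p.1 ∧ StrictMono p.2 := by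
  refine ⟨Fin.strictMono_iff_lt_succ.2 fun i => (hp i).1.trans (hp i).2, ?_⟩
  cases n with
  | zero => exact fun i => i.elim0
  | succ k =>
    refine Fin.strictMono_iff_lt_succ.2 fun i => (hp i.castSucc).2.trans ?_
    rw [Fin.succ_castSucc]
    exact (hp i.succ).1

theorem setIntegral_WC_mul_qkerC {n : ℕ} {t : ℝ} (ht : 0 < t) {F : (Fin (n+1) → ℝ) → ℝ}
    (hF : Integrable F) (x' : Fin (n+1) → ℝ) (y' : Fin n → ℝ) :
    ∫ p in WC n, F p.1 * qkerC n t p.1 p.2 x' y' =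
      ∫ x in {x : Fin (n+1) → ℝ | StrictMono x},
        F x * (Matrix.of fun i j => gauss t (x' j - x i)).det := by
  have hint : Integrable fun p : (Fin (n+1) → ℝ) × (Fin n → ℝ) =>
      F p.1 * qkerC n t p.1 p.2 x' y' := by
    simp only [qkerC_eq_det_rows]
    exact integrable_mul_det_rows_sum hF (measurable_qkerRowX ht x' y')
      (abs_qkerRowX_le ht x' y') fun _ j => integrable_qkerRowY ht x' y' j
  rw [← integral_indicator (measurableSet_WC n), Measure.volume_eq_prod,
    integral_prod _ (hint.indicator (measurableSet_WC n)),
    ← integral_indicator measurableSet_strictMono]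
  refine integral_congr_ae (Filter.Eventually.of_forall fun x => ?_)
  by_cases hx : StrictMono x
  · have hslice : ∀ y : Fin n → ℝ,
        (WC n).indicator (fun p => F p.1 * qkerC n t p.1 p.2 x' y') (x, y) =
        (Set.univ.pi fun i : Fin n => Set.Ioo (x i.castSucc) (x i.succ)).indicator
          (fun y => F x * qkerC n t x y x' y') y := fun y => by
      classical
      rw [Set.indicator_apply, Set.indicator_apply]
      exact if_congr Set.mem_univ_pi.symm rfl rfl
    simp only [hslice]
    rw [integral_indicator (MeasurableSet.univ_pi fun _ => measurableSet_Ioo),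
      integral_const_mul, setIntegral_qkerC ht hx]
    rw [Set.indicator_of_mem (s := {x : Fin (n+1) → ℝ | StrictMono x}) hx]
  · have hslice : ∀ y : Fin n → ℝ,
        (WC n).indicator (fun p => F p.1 * qkerC n t p.1 p.2 x' y') (x, y) = 0 := fun y =>
      Set.indicator_of_notMem (fun h => hx (strictMono_of_mem_WC h).1) _
    simp only [hslice, integral_zero]
    exact (Set.indicator_of_notMem (s := {x : Fin (n+1) → ℝ | StrictMono x}) hx _).symm

theorem exp_neg_sum_sq_div {m : ℕ} (s : ℝ) (x : Fin m → ℝ) :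
    Real.exp (-(∑ i, x i ^ 2) / (2 * s)) = ∏ i, Real.exp (-x i ^ 2 / (2 * s)) := by
  rw [← Real.exp_sum, ← Finset.sum_div, Finset.sum_neg_distrib]

theorem integrable_exp_mul_vandR {m : ℕ} {s : ℝ} (hs : 0 < s) :
    Integrable fun x : Fin m → ℝ => Real.exp (-(∑ i, x i ^ 2) / (2 * s)) * vandR m x := by
  refine (integrable_det_rows
    (f := fun (_ j : Fin m) z => Real.exp (-z ^ 2 / (2 * s)) * z ^ (j : ℕ)) fun _ j => ?_).congr (Filter.Eventually.of_forall fun x => ?_)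
  · simpa only [mul_comm] using integrable_pow_mul_exp_neg_sq_div hs j
  · simp only [exp_neg_sum_sq_div, vandR_eq_det]
    exact Matrix.det_mul_column _ _

/-- The Gaussian-weighted Vandermonde function evolves in closed form under the Karlin-McGregor
kernel on the Weyl chamber. -/
theorem setIntegral_exp_mul_vandR_mul_det {m : ℕ} {s t : ℝ} (hs : 0 < s) (ht : 0 < t)
    (x' : Fin m → ℝ) :
    ∫ x in {x : Fin m → ℝ | StrictMono x}, Real.exp (-(∑ i, x i ^ 2) / (2 * s)) * vandR m x *
        (Matrix.of fun i j => gauss t (x' j - x i)).det =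
      Real.sqrt (s / (s + t)) ^ m * (s / (s + t)) ^ (m * (m - 1) / 2) *
        (Real.exp (-(∑ i, x' i ^ 2) / (2 * (s + t))) * vandR m x') := by
  let f : Fin m → Fin m → ℝ → ℝ :=
    fun i j z => Real.exp (-z ^ 2 / (2 * s)) * gauss t (x' i - z) * z ^ (j : ℕ)
  have hf : ∀ i j, Integrable (f i j) := fun i j =>
    integrable_exp_mul_gauss_sub_mul_pow hs ht (x' i) j
  let G : (Fin m → ℝ) → ℝ := fun x => (Matrix.of fun i j => f i j (x i)).det
  have hG : ∀ x, G x = (∏ i, Real.exp (-x i ^ 2 / (2 * s)) * gauss t (x' i - x i)) * vandR m x :=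
    fun x => by
      rw [vandR_eq_det]
      exact Matrix.det_mul_column _ _
  have hsymm : ∀ x : Fin m → ℝ, Real.exp (-(∑ i, x i ^ 2) / (2 * s)) * vandR m x *
      (Matrix.of fun i j => gauss t (x' j - x i)).det = ∑ σ : Equiv.Perm (Fin m), G (x ∘ σ) :=
    fun x => by
      rw [Matrix.det_apply', Finset.mul_sum]
      refine Finset.sum_congr rfl fun σ _ => ?_
      rw [hG, vandR_comp_perm, Finset.prod_mul_distrib, exp_neg_sum_sq_div,
        ← Equiv.prod_comp σ fun i => Real.exp (-x i ^ 2 / (2 * s))]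
      simp only [Matrix.of_apply, Function.comp_apply]
      ring
  simp only [hsymm]
  rw [setIntegral_strictMono_sum_comp_perm (integrable_det_rows hf), integral_det_rows hf]
  simp only [f, integral_exp_mul_gauss_sub_mul_pow hs ht]
  have hv : 0 < s * t / (s + t) := by positivity
  have hcol := Matrix.det_mul_column
    (fun i => Real.sqrt (s / (s + t)) * Real.exp (-x' i ^ 2 / (2 * (s + t))))
    (Matrix.of fun i j : Fin m =>
      (gaussMomentPoly (s * t / (s + t)) j).eval (s / (s + t) * x' i))
  simp only [Matrix.of_apply] at hcol
  rw [hcol, ← Matrix.det_eval_matrixOfPolynomials_eq_det_vandermonde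
    (fun i => s / (s + t) * x' i) (fun j : Fin m => gaussMomentPoly (s * t / (s + t)) j)
    (fun j => natDegree_gaussMomentPoly hv j) (fun j => monic_gaussMomentPoly hv j),
    ← vandR_eq_det, vandR_const_mul, Finset.prod_mul_distrib, exp_neg_sum_sq_div]
  simp only [Finset.prod_const, Finset.card_univ, Fintype.card_fin]
  ring

theorem rpow_mul_sqrt_div_pow_mul_div_pow {s r : ℝ} (hs : 0 < s) (hr : 0 < r) (n : ℕ) :
    s ^ (-(((n : ℝ) + 1) ^ 2) / 2) *
        (Real.sqrt (s / r) ^ (n + 1) * (s / r) ^ ((n + 1) * (n + 1 - 1) / 2)) =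
      r ^ (-(((n : ℝ) + 1) ^ 2) / 2) := by
  have hk : (((n + 1) * (n + 1 - 1) / 2 : ℕ) : ℝ) = ((n : ℝ) + 1) * n / 2 := by
    rw [Nat.cast_div (Nat.even_mul_pred_self (n + 1)).two_dvd two_ne_zero]
    push_cast
    simp
  have hq : 0 < s / r := by positivity
  rw [Real.sqrt_eq_rpow, ← Real.rpow_natCast ((s / r) ^ _), ← Real.rpow_mul hq.le,
    ← Real.rpow_natCast (s / r), hk, ← Real.rpow_add hq]
  have he : 1 / 2 * ((n + 1 : ℕ) : ℝ) + ((n : ℝ) + 1) * n / 2 = -(-(((n : ℝ) + 1) ^ 2) / 2) := by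
    push_cast
    ring
  rw [he, Real.rpow_neg hq.le, Real.div_rpow hs.le hr.le]
  have h1 := (Real.rpow_pos_of_pos hs (-(((n : ℝ) + 1) ^ 2) / 2)).ne'
  have h2 := (Real.rpow_pos_of_pos hr (-(((n : ℝ) + 1) ^ 2) / 2)).ne'
  field_simp

/-- the entrance-law identity
`∫_{W^{n,n+1}} ν_s^n(x,y) q_t^{n,+}((x,y),(x',y')) dx dy = ν_{s+t}^n(x',y')`. -/
theorem nu_entrance_law (n : ℕ) (s t : ℝ) (hs : 0 < s) (ht : 0 < t)
    (x' : Fin (n+1) → ℝ) (y' : Fin n → ℝ) (h : (x', y') ∈ WC n) :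
    ∫ p in WC n,
        nuC n s p.1 p.2 * ((vandR n y' / vandR n p.2) * qkerC n t p.1 p.2 x' y')
      = nuC n (s+t) x' y' := by
  have hcancel : ∀ p ∈ WC n,
      nuC n s p.1 p.2 * ((vandR n y' / vandR n p.2) * qkerC n t p.1 p.2 x' y') =
      ((n.factorial : ℝ) / ((2 * Real.pi) ^ (((n : ℝ) + 1) / 2)
          * ∏ j ∈ Finset.range (n+1), (j.factorial : ℝ))
        * s ^ (-(((n : ℝ) + 1)^2) / 2) * vandR n y') *
      ((Real.exp (-(∑ i, (p.1 i)^2) / (2*s)) * vandR (n+1) p.1) * qkerC n t p.1 p.2 x' y') :=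
    fun p hp => by
      have hne := (vandR_pos (strictMono_of_mem_WC hp).2).ne'
      rw [nuC]
      generalize vandR n p.2 = v at hne ⊢
      generalize ((n.factorial : ℝ) / ((2 * Real.pi) ^ (((n : ℝ) + 1) / 2)
          * ∏ j ∈ Finset.range (n+1), (j.factorial : ℝ))) = c
      field_simp
  rw [setIntegral_congr_fun (measurableSet_WC n) hcancel, integral_const_mul,
    setIntegral_WC_mul_qkerC ht (integrable_exp_mul_vandR hs),
    setIntegral_exp_mul_vandR_mul_det hs ht, nuC,
    ← rpow_mul_sqrt_div_pow_mul_div_pow hs (add_pos hs ht) n]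
  ring
end
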